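/- Let u be a nonnegative harmonic function on the unit disc and 0 ≤ r < 1. Then (1/2π)∫₀^{2π}|u(re^{iθ}) - u(0)| dθ ≤ u(0)·(2 - (4/π)arccos r). -/

import Mathlib

open MeasureTheory Metric

/-- The Poisson kernel on the unit circle. -/
noncomputable def pK (s t : ℝ) : ℝ := (1 - s ^ 2) / (1 - 2 * s * Real.cos t + s ^ 2)

lemma pK_den_pos {s : ℝ} (h0 : 0 ≤ s) (h1 : s < 1) (t : ℝ) :
    0 < 1 - 2 * s * Real.cos t + s ^ 2 := by
  nlinarith [Real.cos_le_one t, mul_nonneg h0 (sub_nonneg.2 (Real.cos_le_one t)),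
    pow_pos (sub_pos.2 h1) 2]

lemma pK_cont {s : ℝ} (h0 : 0 ≤ s) (h1 : s < 1) : Continuous (pK s) := by
  unfold pK
  exact Continuous.div (by fun_prop) (by fun_prop) (fun t => (pK_den_pos h0 h1 t).ne')

lemma pK_sub_one {s : ℝ} (h0 : 0 ≤ s) (h1 : s < 1) (t : ℝ) :
    pK s t - 1 = 2 * s * (Real.cos t - s) / (1 - 2 * s * Real.cos t + s ^ 2) := by
  unfold pK
  have := (pK_den_pos h0 h1 t).ne'
  rw [div_sub_one this]
  congr 1
  ring

noncomputable def pF (s t : ℝ) : ℝ :=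
  2 * Real.arctan (s * Real.sin t / (1 - s * Real.cos t))

lemma pF_deriv {s : ℝ} (h0 : 0 ≤ s) (h1 : s < 1) (t : ℝ) :
    HasDerivAt (pF s) (pK s t - 1) t := by
  have hd : 0 < 1 - s * Real.cos t := by
    nlinarith [Real.cos_le_one t, mul_nonneg h0 (sub_nonneg.2 (Real.cos_le_one t))]
  have hq := pK_den_pos h0 h1 t
  have h := ((((Real.hasDerivAt_sin t).const_mul s).div
    (((Real.hasDerivAt_cos t).const_mul s).const_sub 1) hd.ne').arctan).const_mul 2
  refine h.congr_deriv ?_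
  rw [pK_sub_one h0 h1]
  have hs := Real.sin_sq_add_cos_sq t
  simp only [Pi.div_apply]
  have e : 1 + (s * Real.sin t / (1 - s * Real.cos t)) ^ 2
      = (1 - 2 * s * Real.cos t + s ^ 2) / (1 - s * Real.cos t) ^ 2 := by
    field_simp
    linear_combination s ^ 2 * hs
  rw [e]
  field_simp
  linear_combination (-s ^ 2) * hs

lemma pF_int {s : ℝ} (h0 : 0 ≤ s) (h1 : s < 1) (a b : ℝ) :
    ∫ t in a..b, (pK s t - 1) = pF s b - pF s a :=
  intervalIntegral.integral_eq_sub_of_hasDerivAt (fun t _ => pF_deriv h0 h1 t)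
    (((pK_cont h0 h1).sub continuous_const).intervalIntegrable _ _)

lemma pK_abs_int {s : ℝ} (h0 : 0 ≤ s) (h1 : s < 1) (x : ℝ) :
    ∫ θ in (0:ℝ)..(2 * Real.pi), |pK s (θ - x) - 1| = 8 * Real.arcsin s := by
  have hper : Function.Periodic (fun t => |pK s t - 1|) (2 * Real.pi) := by
    intro t
    simp [pK, Real.cos_add_two_pi]
  rw [intervalIntegral.integral_comp_sub_right (fun t => |pK s t - 1|) x]
  set α := Real.arccos s with hα
  have hα0 : 0 ≤ α := Real.arccos_nonneg s
  have hαp : α ≤ Real.pi / 2 := Real.arccos_le_pi_div_two.2 h0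
  have hpi := Real.pi_pos
  have hcos : Real.cos α = s := Real.cos_arccos (by linarith) h1.le
  have hsin : Real.sin α = √(1 - s ^ 2) := Real.sin_arccos s
  have e := hper.intervalIntegral_add_eq (0 - x) (-α)
  rw [show 0 - x + 2 * Real.pi = 2 * Real.pi - x by ring] at e
  rw [e]
  have hc : Continuous (fun t => |pK s t - 1|) := ((pK_cont h0 h1).sub continuous_const).abs
  rw [← intervalIntegral.integral_add_adjacent_intervals
    (hc.intervalIntegrable (-α) α) (hc.intervalIntegrable α (-α + 2 * Real.pi))]
  have i1 : ∫ t in (-α)..α, |pK s t - 1| = ∫ t in (-α)..α, (pK s t - 1) := by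
    apply intervalIntegral.integral_congr
    intro t ht
    rw [Set.uIcc_of_le (by linarith)] at ht
    have : s ≤ Real.cos t := by
      rw [← hcos, ← Real.cos_abs t]
      exact Real.cos_le_cos_of_nonneg_of_le_pi (abs_nonneg t) (by linarith) (abs_le.2 ht)
    apply abs_of_nonneg
    rw [pK_sub_one h0 h1]
    exact div_nonneg (mul_nonneg (by linarith) (by linarith)) (pK_den_pos h0 h1 t).le
  have i2 : ∫ t in α..(-α + 2 * Real.pi), |pK s t - 1|
      = ∫ t in α..(-α + 2 * Real.pi), -(pK s t - 1) := by
    apply intervalIntegral.integral_congr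
    intro t ht
    rw [Set.uIcc_of_le (by linarith)] at ht
    have : Real.cos t ≤ s := by
      rw [← hcos]
      rcases le_total t Real.pi with h | h
      · exact Real.cos_le_cos_of_nonneg_of_le_pi hα0 h ht.1
      · rw [← Real.cos_two_pi_sub t]
        exact Real.cos_le_cos_of_nonneg_of_le_pi hα0 (by linarith) (by linarith [ht.2])
    apply abs_of_nonpos
    rw [pK_sub_one h0 h1]
    exact div_nonpos_of_nonpos_of_nonneg (mul_nonpos_of_nonneg_of_nonpos (by linarith)
      (by linarith)) (pK_den_pos h0 h1 t).le
  rw [i1, i2, intervalIntegral.integral_neg, pF_int h0 h1, pF_int h0 h1]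
  have hpF : pF s α = 2 * Real.arcsin s := by
    rw [Real.arcsin_eq_arctan ⟨by linarith, h1⟩]
    unfold pF
    rw [hcos, hsin]
    have h2 : 0 < 1 - s ^ 2 := by nlinarith
    have h3 : √(1 - s ^ 2) ≠ 0 := (Real.sqrt_pos.2 h2).ne'
    have h4 := Real.sq_sqrt h2.le
    congr 2
    rw [div_eq_div_iff (by nlinarith) h3]
    linear_combination s * h4
  have hpF2 : pF s (-α) = - pF s α := by
    simp [pF, neg_div, Real.arctan_neg]
  have hpF3 : pF s (-α + 2 * Real.pi) = pF s (-α) := by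
    simp only [pF, Real.sin_add_two_pi, Real.cos_add_two_pi]
  rw [hpF3, hpF2, hpF]
  ring

lemma poisson_eq {r R : ℝ} (hR : 0 < R) (θ φ : ℝ) :
    poissonKernel 0 (circleMap 0 r θ) (circleMap 0 R φ) = pK (r / R) (θ - φ) := by
  unfold poissonKernel pK
  have e : ‖circleMap 0 R φ - circleMap 0 r θ‖ ^ 2
      = R ^ 2 - 2 * r * R * Real.cos (θ - φ) + r ^ 2 := by
    rw [← Complex.normSq_eq_norm_sq, Complex.normSq_apply, Real.cos_sub]
    simp only [circleMap, zero_add, Complex.sub_re, Complex.sub_im, Complex.re_ofReal_mul,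
      Complex.im_ofReal_mul, Complex.exp_ofReal_mul_I_re, Complex.exp_ofReal_mul_I_im]
    linear_combination R ^ 2 * Real.sin_sq_add_cos_sq φ + r ^ 2 * Real.sin_sq_add_cos_sq θ
  simp only [sub_zero, e, norm_circleMap_zero, sq_abs]
  rw [← mul_div_mul_left (1 - (r / R) ^ 2) _ (pow_ne_zero 2 hR.ne')]
  congr 1 <;> field_simp

lemma main_R (u : ℂ → ℝ) (g : ℂ → ℂ) (hg : DifferentiableOn ℂ g (ball 0 1))
    (hu : ∀ z ∈ ball (0:ℂ) 1, u z = (g z).re)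
    (hpos : ∀ z ∈ ball (0:ℂ) 1, 0 ≤ u z)
    (r R : ℝ) (hr0 : 0 ≤ r) (hrR : r < R) (hR1 : R < 1) :
    ∫ θ in (0:ℝ)..(2 * Real.pi), |u (circleMap 0 r θ) - u 0| ≤
      u 0 * (8 * Real.arcsin (r / R)) := by
  have hR : 0 < R := hr0.trans_lt hrR
  have hs0 : 0 ≤ r / R := div_nonneg hr0 hR.le
  have hs1 : r / R < 1 := (div_lt_one hR).2 hrR
  have hpi := Real.pi_pos
  have mem : ∀ ρ : ℝ, 0 ≤ ρ → ρ < 1 → ∀ θ, circleMap 0 ρ θ ∈ ball (0:ℂ) 1 := by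
    intro ρ h h' θ
    simpa [abs_of_nonneg h] using h'
  have hcu : ∀ ρ : ℝ, 0 ≤ ρ → ρ < 1 → Continuous fun θ => u (circleMap 0 ρ θ) := by
    intro ρ h h'
    have : (fun θ => u (circleMap 0 ρ θ)) = fun θ => (g (circleMap 0 ρ θ)).re := by
      funext θ
      exact hu _ (mem ρ h h' θ)
    rw [this]
    exact Complex.continuous_re.comp
      (hg.continuousOn.comp_continuous (continuous_circleMap 0 ρ) (mem ρ h h'))
  have hK := pK_cont hs0 hs1
  have hcR := hcu R hR.le hR1
  have hD : DiffContOnCl ℂ g (ball 0 R) := by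
    apply DifferentiableOn.diffContOnCl
    rw [closure_ball 0 hR.ne']
    exact hg.mono (closedBall_subset_ball hR1)
  -- real Poisson formula
  have hP : ∀ θ : ℝ, ∀ ρ : ℝ, 0 ≤ ρ → ρ < R → u (circleMap 0 ρ θ) =
      (2 * Real.pi)⁻¹ * ∫ φ in (0:ℝ)..(2 * Real.pi),
        pK (ρ / R) (θ - φ) * u (circleMap 0 R φ) := by
    intro θ ρ h h'
    have hw : circleMap 0 ρ θ ∈ ball (0:ℂ) R := by simpa [abs_of_nonneg h] using h'
    have hk := pK_cont (div_nonneg h hR.le) ((div_lt_one hR).2 h')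
    have f := hD.circleAverage_poissonKernel_smul hw
    rw [hu _ (mem ρ h (h'.trans hR1) θ), ← f, Real.circleAverage_def]
    rw [Complex.smul_re, smul_eq_mul]
    congr 1
    have hgc : Continuous fun φ => g (circleMap 0 R φ) :=
      hg.continuousOn.comp_continuous (continuous_circleMap 0 R) (mem R hR.le hR1)
    have : (fun φ => (poissonKernel 0 (circleMap 0 ρ θ) • g) (circleMap 0 R φ))
        = fun φ => (pK (ρ / R) (θ - φ)) • g (circleMap 0 R φ) := by
      funext φ
      rw [Pi.smul_apply', poisson_eq hR]
    rw [this]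
    have hi : IntervalIntegrable (fun φ => (pK (ρ / R) (θ - φ)) • g (circleMap 0 R φ))
        volume 0 (2 * Real.pi) :=
      ((hk.comp (by fun_prop : Continuous fun φ => θ - φ)).smul hgc).intervalIntegrable _ _
    have c := Complex.reCLM.intervalIntegral_comp_comm hi
    simp only [Complex.reCLM_apply] at c
    rw [← c]
    apply intervalIntegral.integral_congr
    intro φ _
    simp [hu _ (mem R hR.le hR1 φ)]
  have h00 : u 0 = (2 * Real.pi)⁻¹ * ∫ φ in (0:ℝ)..(2 * Real.pi), u (circleMap 0 R φ) := by
    have := hP 0 0 le_rfl hR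
    simpa [pK] using this
  have hsub : ∀ θ, |u (circleMap 0 r θ) - u 0| ≤ (2 * Real.pi)⁻¹ *
      ∫ φ in (0:ℝ)..(2 * Real.pi), |pK (r / R) (θ - φ) - 1| * u (circleMap 0 R φ) := by
    intro θ
    have hk : Continuous fun φ => pK (r / R) (θ - φ) := hK.comp (by fun_prop)
    have hkc : Continuous fun φ => pK (r / R) (θ - φ) * u (circleMap 0 R φ) := hk.mul hcR
    rw [hP θ r hr0 hrR, h00, ← mul_sub, ← intervalIntegral.integral_sub
      (hkc.intervalIntegrable _ _) (hcR.intervalIntegrable _ _), abs_mul,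
      abs_of_pos (by positivity : 0 < (2 * Real.pi)⁻¹)]
    apply mul_le_mul_of_nonneg_left _ (by positivity)
    refine (intervalIntegral.abs_integral_le_integral_abs (by positivity)).trans_eq ?_
    apply intervalIntegral.integral_congr
    intro φ _
    simp only
    rw [← sub_one_mul, abs_mul, abs_of_nonneg (hpos _ (mem R hR.le hR1 φ))]
  have hF : Continuous (Function.uncurry fun θ φ : ℝ =>
      |pK (r / R) (θ - φ) - 1| * u (circleMap 0 R φ)) := by
    apply Continuous.mul
    · exact ((hK.comp (by fun_prop : Continuous fun p : ℝ × ℝ => p.1 - p.2)).sub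
        continuous_const).abs
    · exact hcR.comp continuous_snd
  have hswap := intervalIntegral_intervalIntegral_swap (F := fun θ φ : ℝ =>
      |pK (r / R) (θ - φ) - 1| * u (circleMap 0 R φ)) (a := 0) (b := 2 * Real.pi)
      (c := 0) (d := 2 * Real.pi) (by
        refine IntegrableOn.mono_set (hF.continuousOn.integrableOn_compact
          (isCompact_uIcc.prod isCompact_uIcc))
          (Set.prod_mono Set.uIoc_subset_uIcc Set.uIoc_subset_uIcc))
  have hint : Continuous fun θ : ℝ => ∫ φ in (0:ℝ)..(2 * Real.pi),
      |pK (r / R) (θ - φ) - 1| * u (circleMap 0 R φ) :=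
    intervalIntegral.continuous_parametric_intervalIntegral_of_continuous' hF _ _
  calc _ ≤ ∫ θ in (0:ℝ)..(2 * Real.pi), (2 * Real.pi)⁻¹ *
      ∫ φ in (0:ℝ)..(2 * Real.pi), |pK (r / R) (θ - φ) - 1| * u (circleMap 0 R φ) := by
        apply intervalIntegral.integral_mono_on (by positivity)
        · exact (((hcu r hr0 (hrR.trans hR1)).sub continuous_const).abs).intervalIntegrable _ _
        · exact (continuous_const.mul hint).intervalIntegrable _ _
        · intro θ _
          exact hsub θ
    _ = (2 * Real.pi)⁻¹ * ∫ φ in (0:ℝ)..(2 * Real.pi), ∫ θ in (0:ℝ)..(2 * Real.pi),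
        |pK (r / R) (θ - φ) - 1| * u (circleMap 0 R φ) := by
        rw [intervalIntegral.integral_const_mul, hswap]
    _ = u 0 * (8 * Real.arcsin (r / R)) := by
        simp_rw [intervalIntegral.integral_mul_const, pK_abs_int hs0 hs1]
        rw [intervalIntegral.integral_const_mul, h00]
        ring

theorem stmt_15 (u : ℂ → ℝ)
    (hharm : ∃ g : ℂ → ℂ, DifferentiableOn ℂ g (ball 0 1) ∧
      ∀ z ∈ ball (0:ℂ) 1, u z = (g z).re)
    (hpos : ∀ z ∈ ball (0:ℂ) 1, 0 ≤ u z)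
    (r : ℝ) (hr0 : 0 ≤ r) (hr1 : r < 1) :
    (1 / (2 * Real.pi)) * ∫ θ in (0:ℝ)..(2 * Real.pi),
        |u (r * Complex.exp (θ * Complex.I)) - u 0| ≤
      u 0 * (2 - (4 / Real.pi) * Real.arccos r) := by
  obtain ⟨g, hg, hu⟩ := hharm
  have hpi := Real.pi_pos
  have key : ∫ θ in (0:ℝ)..(2 * Real.pi), |u (r * Complex.exp (θ * Complex.I)) - u 0| ≤
      u 0 * (8 * Real.arcsin (r / 1)) := by
    have ht : Filter.Tendsto (fun R : ℝ => u 0 * (8 * Real.arcsin (r / R)))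
        (nhdsWithin 1 (Set.Iio 1)) (nhds (u 0 * (8 * Real.arcsin (r / 1)))) := by
      have : ContinuousAt (fun R : ℝ => u 0 * (8 * Real.arcsin (r / R))) 1 := by
        have h1 : ContinuousAt (fun R : ℝ => r / R) 1 :=
          continuousAt_const.div continuousAt_id one_ne_zero
        have h2 : ContinuousAt (fun R : ℝ => Real.arcsin (r / R)) 1 :=
          Real.continuous_arcsin.continuousAt.comp h1
        exact continuousAt_const.mul (continuousAt_const.mul h2)
      exact this.tendsto.mono_left nhdsWithin_le_nhds
    refine ge_of_tendsto ht ?_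
    filter_upwards [Ioo_mem_nhdsLT hr1] with R hR
    have := main_R u g hg hu hpos r R hr0 hR.1 hR.2
    simpa only [circleMap, zero_add] using this
  rw [div_one] at key
  calc _ ≤ (1 / (2 * Real.pi)) * (u 0 * (8 * Real.arcsin r)) :=
        mul_le_mul_of_nonneg_left key (by positivity)
    _ = _ := by
        rw [Real.arccos]
        field_simp
        ring
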